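/- arXiv:2105.04074 — 8 statements merged into one kernel-verified Lean document; each statement's English description precedes it below -/
import Mathlib

section
/- For every integer n ≥ 1 and every d = (d₁,d₂) ∈ ℤ², the vanishing ideal I(Ω(d)) in ℂ[θ₁,θ₂] of the set Ω(d) = {a ∈ S_n : a + d ∉ S_n} is the principal ideal generated by (H₁, h₁(−d)−1)! · (H₂, h₂(−d)−1)!, i.e., by (∏_{j=0}^{−d₂−1}(θ₂ − j)) · (∏_{j=0}^{−n d₁+d₂−1}(n θ₁ − θ₂ − j)), where an empty product (upper index negative) is 1. -/
open MvPolynomial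

noncomputable section

/-- The polynomial ring ℂ[θ₁, θ₂]. -/
abbrev Cθ : Type := MvPolynomial (Fin 2) ℂ

/-- The vanishing ideal of a set `V ⊆ ℤ²` inside ℂ[θ₁, θ₂]. -/
def vanishingIdeal (V : Set (ℤ × ℤ)) : Ideal Cθ where
  carrier := {f | ∀ a ∈ V, eval ![(a.1 : ℂ), (a.2 : ℂ)] f = 0}
  add_mem' := by
    intro f g hf hg a ha
    simp [map_add, hf a ha, hg a ha]
  zero_mem' := by
    intro a _
    simp
  smul_mem' := by
    intro c f hf a ha
    simp [smul_eq_mul, hf a ha]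

/-- The descending factorial `(P, m)! = ∏_{j=0}^{m} (P - j)`, equal to `1` when `m < 0`. -/
def dfact (P : Cθ) (m : ℤ) : Cθ :=
  ∏ j ∈ Finset.range (m + 1).toNat, (P - C (j : ℂ))

/-- The saturated affine semigroup `S_n = {(x, y) ∈ ℤ² : 0 ≤ y ≤ n x}` of the rational
normal curve of degree `n`. -/
def Sset (n : ℤ) : Set (ℤ × ℤ) := {a | 0 ≤ a.2 ∧ a.2 ≤ n * a.1}

/-- `Ω(d) = {a ∈ S_n : a + d ∉ S_n}`. -/
def Omega (n : ℤ) (d : ℤ × ℤ) : Set (ℤ × ℤ) := {a | a ∈ Sset n ∧ a + d ∉ Sset n}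

/-- The restriction of a polynomial in `θ₁, θ₂` to the graph `θ₂ = q(θ₁)`. -/
def graphRestrict (q : Polynomial ℂ) : Cθ →ₐ[ℂ] Polynomial ℂ := aeval ![Polynomial.X, q]

lemma eval_graphRestrict (q : Polynomial ℂ) (f : Cθ) (x : ℂ) :
    (graphRestrict q f).eval x = eval ![x, q.eval x] f := by
  have h : (Polynomial.aeval x).comp (graphRestrict q) =
      (aeval ![x, q.eval x] : Cθ →ₐ[ℂ] ℂ) := by
    apply MvPolynomial.algHom_ext
    intro i
    fin_cases i <;> simp [graphRestrict]
  have hf := DFunLike.congr_fun h f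
  rwa [AlgHom.comp_apply, Polynomial.coe_aeval_eq_eval, MvPolynomial.aeval_eq_eval] at hf

/-- A polynomial vanishing on the graph of `q` is divisible by `θ₂ - q(θ₁)`. -/
lemma dvd_of_graphRestrict_eq_zero (q : Polynomial ℂ) (f : Cθ) (hf : graphRestrict q f = 0) :
    X 1 - Polynomial.aeval (X 0 : Cθ) q ∣ f := by
  set I : Ideal Cθ := Ideal.span {X 1 - Polynomial.aeval (X 0 : Cθ) q}
  have h : (Ideal.Quotient.mkₐ ℂ I).comp
      ((Polynomial.aeval (X 0 : Cθ)).comp (graphRestrict q)) = Ideal.Quotient.mkₐ ℂ I := by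
    apply MvPolynomial.algHom_ext
    intro i
    fin_cases i
    · simp [graphRestrict]
    · have : Ideal.Quotient.mk I (X 1) = Ideal.Quotient.mk I (Polynomial.aeval (X 0 : Cθ) q) :=
        Ideal.Quotient.eq.mpr (Ideal.mem_span_singleton_self _)
      simp [graphRestrict, this]
  have hI : Ideal.Quotient.mk I f = 0 := by
    simpa [hf] using (DFunLike.congr_fun h f).symm
  exact Ideal.mem_span_singleton.mp (Ideal.Quotient.eq_zero_iff_mem.mp hI)

lemma graphRestrict_eq_zero_of_forall_ge (q : Polynomial ℂ) (f : Cθ) (N : ℤ)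
    (h : ∀ x : ℤ, N ≤ x → eval ![(x : ℂ), q.eval (x : ℂ)] f = 0) : graphRestrict q f = 0 := by
  apply Polynomial.eq_zero_of_infinite_isRoot
  refine ((Set.Ici_infinite N).image (f := fun x : ℤ => (x : ℂ))
    Int.cast_injective.injOn).mono ?_
  rintro _ ⟨x, hx, rfl⟩
  exact (eval_graphRestrict q f x).trans (h x hx)

/-- If each `L i` generates the kernel of a map `φ i` to a domain, and `φ i` does not kill `L j`
for `i ≠ j`, then an element killed by every `φ i` is divisible by the product of the `L i`. -/
lemma prod_dvd_of_forall_map_eq_zero {ι R S : Type*} [CommRing R] [CommRing S] [IsDomain S]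
    (s : Finset ι) (L : ι → R) (φ : ι → R →+* S)
    (hker : ∀ i ∈ s, ∀ f, φ i f = 0 → L i ∣ f)
    (hne : ∀ i ∈ s, ∀ j ∈ s, i ≠ j → φ i (L j) ≠ 0) (f : R) (hf : ∀ i ∈ s, φ i f = 0) :
    ∏ i ∈ s, L i ∣ f := by
  classical
  induction s using Finset.induction_on with
  | empty => simp
  | insert a s ha ih =>
    obtain ⟨g, rfl⟩ := ih (fun i hi => hker i (Finset.mem_insert_of_mem hi))
      (fun i hi j hj => hne i (Finset.mem_insert_of_mem hi) j (Finset.mem_insert_of_mem hj))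
      (fun i hi => hf i (Finset.mem_insert_of_mem hi))
    have haf := hf a (Finset.mem_insert_self a s)
    have hprod : φ a (∏ i ∈ s, L i) ≠ 0 := by
      rw [map_prod]
      exact Finset.prod_ne_zero_iff.mpr fun i hi =>
        hne a (Finset.mem_insert_self a s) i (Finset.mem_insert_of_mem hi)
          (ne_of_mem_of_not_mem hi ha).symm
    rw [map_mul] at haf
    rw [Finset.prod_insert ha, mul_comm (L a)]
    exact mul_dvd_mul_left _
      (hker a (Finset.mem_insert_self a s) g ((mul_eq_zero.mp haf).resolve_left hprod))

lemma eval_dfact_eq_zero (P : Cθ) (m k : ℤ) (v : Fin 2 → ℂ) (hP : eval v P = k) (h0 : 0 ≤ k)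
    (hk : k ≤ m) : eval v (dfact P m) = 0 := by
  lift k to ℕ using h0
  rw [dfact, map_prod]
  apply Finset.prod_eq_zero (i := k) (Finset.mem_range.mpr (by omega))
  simp [hP]

lemma dfact_mul_dfact_dvd (n : ℂ) (hn : n ≠ 0) (k l : ℤ) (f : Cθ)
    (h₁ : ∀ j : ℕ, (j : ℤ) ≤ k → graphRestrict (Polynomial.C (j : ℂ)) f = 0)
    (h₂ : ∀ j : ℕ, (j : ℤ) ≤ l →
      graphRestrict (Polynomial.C n * Polynomial.X - Polynomial.C (j : ℂ)) f = 0) :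
    dfact (X 1) k * dfact (C n * X 0 - X 1) l ∣ f := by
  have hlin (c : ℂ) : Polynomial.C n * Polynomial.X - Polynomial.C c ≠ 0 := fun h =>
    hn (by simpa using congrArg (Polynomial.coeff · 1) h)
  have key := prod_dvd_of_forall_map_eq_zero
    ((Finset.range (k + 1).toNat).disjSum (Finset.range (l + 1).toNat))
    (Sum.elim (fun j : ℕ => (X 1 - C (j : ℂ) : Cθ))
      (fun j : ℕ => (C n * X 0 - X 1 - C (j : ℂ) : Cθ)))
    (Sum.elim (fun j : ℕ => (graphRestrict (Polynomial.C (j : ℂ))).toRingHom)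
      (fun j : ℕ => (graphRestrict
        (Polynomial.C n * Polynomial.X - Polynomial.C (j : ℂ))).toRingHom))
    ?_ ?_ f ?_
  · simpa only [dfact, Finset.prod_disjSum, Sum.elim_inl, Sum.elim_inr] using key
  · rintro (i | i) - g hg
    · simpa [MvPolynomial.algebraMap_eq] using dvd_of_graphRestrict_eq_zero _ g hg
    · have hdvd := dvd_of_graphRestrict_eq_zero _ g hg
      rw [← neg_dvd] at hdvd
      convert hdvd using 1
      simp only [Sum.elim_inr, map_sub, map_mul, Polynomial.aeval_C, Polynomial.aeval_X,
        MvPolynomial.algebraMap_eq]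
      ring
  · rintro (i | i) - (j | j) - hij hzero
    · apply hij
      simpa [graphRestrict, sub_eq_zero] using hzero
    · refine hlin (i + j) (Eq.trans ?_ hzero)
      simp [graphRestrict]
      ring
    · refine hlin (i + j) (Eq.trans ?_ hzero)
      simp [graphRestrict]
      ring
    · apply hij
      simpa [graphRestrict, sub_eq_zero] using hzero
  · rintro (i | i) hi
    · have hi := Finset.mem_range.mp (Finset.inl_mem_disjSum.mp hi)
      exact h₁ i (by omega)
    · have hi := Finset.mem_range.mp (Finset.inr_mem_disjSum.mp hi)
      exact h₂ i (by omega)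

/-- The vanishing ideal of `Ω(d)` is principal, generated by
`(H₁, h₁(−d)−1)! ⬝ (H₂, h₂(−d)−1)!` where `H₁ = θ₂`, `H₂ = n θ₁ − θ₂`,
`h₁(−d) − 1 = −d₂ − 1` and `h₂(−d) − 1 = −n d₁ + d₂ − 1`. -/
theorem statement1 (n : ℤ) (hn : 1 ≤ n) (d : ℤ × ℤ) :
    vanishingIdeal (Omega n d) =
      Ideal.span {dfact (X 1) (-d.2 - 1) *
        dfact (C (n : ℂ) * X 0 - X 1) (-(n * d.1) + d.2 - 1)} := by
  apply le_antisymm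
  · intro f hf
    refine Ideal.mem_span_singleton.mpr
      (dfact_mul_dfact_dvd _ (Int.cast_ne_zero.mpr (by omega)) _ _ f ?_ ?_)
    · intro j hj
      refine graphRestrict_eq_zero_of_forall_ge _ f j fun x hx => ?_
      have hmem : (x, (j : ℤ)) ∈ Omega n d := by
        refine ⟨⟨by positivity, ?_⟩, fun h => ?_⟩
        · change (j : ℤ) ≤ n * x
          nlinarith
        · have h1 : 0 ≤ (j : ℤ) + d.2 := h.1
          omega
      simpa using hf _ hmem
    · intro j hj
      refine graphRestrict_eq_zero_of_forall_ge _ f j fun x hx => ?_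
      have hmem : (x, n * x - j) ∈ Omega n d := by
        refine ⟨⟨?_, ?_⟩, fun h => ?_⟩
        · change 0 ≤ n * x - j
          nlinarith
        · change n * x - j ≤ n * x
          omega
        · have h2 : n * x - j + d.2 ≤ n * (x + d.1) := h.2
          linarith
      simpa using hf _ hmem
  · rw [Ideal.span_singleton_le_iff_mem]
    rintro a ⟨⟨ha₁, ha₂⟩, had⟩
    rw [map_mul, mul_eq_zero]
    have hor : a.2 + d.2 < 0 ∨ n * (a.1 + d.1) < a.2 + d.2 := by
      by_contra! h
      exact had h
    refine hor.imp (fun h => ?_) (fun h => ?_)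
    · exact eval_dfact_eq_zero _ _ a.2 _ (by simp) ha₁ (by omega)
    · exact eval_dfact_eq_zero _ _ (n * a.1 - a.2) _ (by simp) (by omega) (by linarith)

end
end

section
/- For every integer n ≥ 1 and every d = (d₁,d₂) ∈ ℤ², the vanishing ideal in ℂ[θ₁,θ₂] of the set Ω(d) ∪ {a ∈ JMon_n : a + d ∉ JMon_n} is the principal ideal generated by ∏_{i ∈ {1,2} with h_i(d) < 0} (H_i, h_i(−d))!, where the product is over those indices i for which h_i(d) < 0 and an empty product is 1. (This set describes the graded piece II(J)_d of the idealizer of the radical monomial ideal J = ⟨st, st², …, stⁿ⁻¹⟩ of R_{A_n}.) -/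
open MvPolynomial

noncomputable section

/-- `JMon_n = {a ∈ S_n : h₁(a) > 0 and h₂(a) > 0}`, the exponents of the monomials of the
radical interior ideal `J = ⟨st, …, stⁿ⁻¹⟩`. -/
def JMon (n : ℤ) : Set (ℤ × ℤ) := {a | a ∈ Sset n ∧ 0 < a.2 ∧ 0 < n * a.1 - a.2}

theorem dfact_eval_eq_zero_iff {v : Fin 2 → ℂ} {P : Cθ} {k : ℤ} (hP : eval v P = (k : ℂ)) (m : ℤ) :
    eval v (dfact P m) = 0 ↔ 0 ≤ k ∧ k ≤ m := by
  simp only [dfact, map_prod, map_sub, hP, eval_C, Finset.prod_eq_zero_iff, Finset.mem_range]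
  constructor
  · rintro ⟨j, hj, h⟩
    have h' : k = (j : ℤ) := by exact_mod_cast sub_eq_zero.mp h
    omega
  · rintro ⟨h0, hm⟩
    lift k to ℕ using h0
    exact ⟨k, by omega, by simp⟩

theorem dfact_dvd {P g : Cθ} {m : ℤ} (h : ∀ j : ℕ, (j : ℤ) ≤ m → P - C (j : ℂ) ∣ g) :
    dfact P m ∣ g := by
  refine Finset.prod_dvd_of_coprime (fun i _ j _ hij => ?_) fun j hj => h j ?_
  · have hne : (j : ℂ) - i ≠ 0 := sub_ne_zero.mpr (by exact_mod_cast hij.symm)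
    refine ⟨C ((j : ℂ) - i)⁻¹, -C ((j : ℂ) - i)⁻¹, ?_⟩
    calc _ = C (((j : ℂ) - i)⁻¹ * ((j : ℂ) - i)) := by
          simp only [C_mul, C_sub]
          ring
      _ = 1 := by rw [inv_mul_cancel₀ hne, C_1]
  · rw [Finset.mem_range] at hj
    omega

/-- A polynomial vanishing at infinitely many points of the graph of `p` is divisible by the
equation of that graph. -/
theorem X_sub_aeval_dvd (p : Polynomial ℂ) (g : Cθ) (N : ℤ)
    (h : ∀ x : ℤ, N ≤ x → eval ![(x : ℂ), p.eval (x : ℂ)] g = 0) :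
    X 1 - Polynomial.aeval (X 0 : Cθ) p ∣ g := by
  have hzero : aeval ![Polynomial.X, p] g = 0 := by
    refine Polynomial.eq_zero_of_infinite_isRoot _ <|
      ((Set.Ici_infinite N).image Int.cast_injective.injOn).mono ?_
    rintro _ ⟨x, hx, rfl⟩
    have hcomp : (Polynomial.aeval (x : ℂ)).comp (aeval ![Polynomial.X, p]) =
        aeval ![(x : ℂ), p.eval (x : ℂ)] := by
      ext i
      fin_cases i <;> simp [Polynomial.coe_aeval_eq_eval]
    have heval := DFunLike.congr_fun hcomp g
    exact heval.trans ((congrFun (congrArg DFunLike.coe (coe_aeval_eq_eval _)) g).trans (h x hx))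
  rw [← Ideal.mem_span_singleton, ← Ideal.Quotient.eq_zero_iff_mem]
  set I := Ideal.span {X 1 - Polynomial.aeval (X 0 : Cθ) p}
  have hcomp : ((Ideal.Quotient.mkₐ ℂ I).comp (Polynomial.aeval (X 0 : Cθ))).comp
      (aeval ![Polynomial.X, p]) = Ideal.Quotient.mkₐ ℂ I := by
    ext i
    fin_cases i
    · simp
    · simpa using (Ideal.Quotient.eq.mpr (Ideal.mem_span_singleton_self _)).symm
  have := DFunLike.congr_fun hcomp g
  simpa [hzero] using this.symm

/-- The graded piece `II(J)_d` of the idealizer: the vanishing ideal of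
`Ω(d) ∪ {a ∈ JMon_n : a + d ∉ JMon_n}` is the principal ideal generated by
`∏_{i : h_i(d) < 0} (H_i, h_i(−d))!` (empty product equal to `1`). -/
theorem statement2 (n : ℤ) (hn : 1 ≤ n) (d : ℤ × ℤ) :
    vanishingIdeal (Omega n d ∪ {a | a ∈ JMon n ∧ a + d ∉ JMon n}) =
      Ideal.span
        {(if d.2 < 0 then dfact (X 1) (-d.2) else 1) *
          (if n * d.1 - d.2 < 0 then
            dfact (C (n : ℂ) * X 0 - X 1) (-(n * d.1 - d.2)) else 1)} := by
  set e := n * d.1 - d.2 with he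
  have evH₁ (a : ℤ × ℤ) : eval ![(a.1 : ℂ), (a.2 : ℂ)] (X 1 : Cθ) = (a.2 : ℂ) := by simp
  have evH₂ (a : ℤ × ℤ) : eval ![(a.1 : ℂ), (a.2 : ℂ)] (C (n : ℂ) * X 0 - X 1 : Cθ)
      = ((n * a.1 - a.2 : ℤ) : ℂ) := by simp
  have mem_iff (a : ℤ × ℤ) : a ∈ Omega n d ∪ {a | a ∈ JMon n ∧ a + d ∉ JMon n} ↔
      (0 ≤ a.2 ∧ 0 ≤ n * a.1 - a.2) ∧ ((a.2 + d.2 < 0 ∨ n * a.1 - a.2 + e < 0) ∨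
        (0 < a.2 ∧ 0 < n * a.1 - a.2) ∧ (a.2 + d.2 ≤ 0 ∨ n * a.1 - a.2 + e ≤ 0)) := by
    simp only [Omega, JMon, Sset, Set.mem_union, Set.mem_ofPred_eq, Prod.fst_add, Prod.snd_add,
      mul_add]
    omega
  apply le_antisymm
  · intro f hf
    rw [Ideal.mem_span_singleton]
    have hD₁ : (if d.2 < 0 then dfact (X 1) (-d.2) else 1) ∣ f := by
      split_ifs with hd
      · refine dfact_dvd fun j hj => ?_
        have := X_sub_aeval_dvd (Polynomial.C (j : ℂ)) f (j + 1) fun x hx => ?_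
        · simpa using this
        · have hnx : x ≤ n * x := le_mul_of_one_le_left (by omega) hn
          simpa using hf (x, j) ((mem_iff _).mpr (by dsimp only; omega))
      · exact one_dvd f
    obtain ⟨g, rfl⟩ := hD₁
    refine mul_dvd_mul_left _ ?_
    split_ifs with hd
    · refine dfact_dvd fun j hj => ?_
      have := X_sub_aeval_dvd (Polynomial.C (n : ℂ) * Polynomial.X - Polynomial.C (j : ℂ)) g
        (j + 1 + |d.2|) fun x hx => ?_
      · rw [← neg_dvd]
        convert this using 1
        simp
        ring
      · have habs := neg_le_abs d.2
        have habs₀ := abs_nonneg d.2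
        have hnx : x ≤ n * x := le_mul_of_one_le_left (by omega) hn
        have hv := hf (x, n * x - j) ((mem_iff _).mpr (by dsimp only; omega))
        rw [map_mul, mul_eq_zero] at hv
        have hne : eval ![(x : ℂ), ((n * x - j : ℤ) : ℂ)]
            (if d.2 < 0 then dfact (X 1) (-d.2) else 1) ≠ 0 := by
          split_ifs
          · rw [Ne, dfact_eval_eq_zero_iff (evH₁ (x, n * x - j))]
            dsimp only
            omega
          · simp
        simpa using hv.resolve_left hne
    · exact one_dvd g
  · rw [Ideal.span_singleton_le_iff_mem]
    intro a ha
    rw [mem_iff] at ha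
    rw [map_mul, mul_eq_zero]
    by_cases h : d.2 < 0 ∧ a.2 ≤ -d.2
    · left
      rw [if_pos h.1, dfact_eval_eq_zero_iff (evH₁ a)]
      omega
    · right
      rw [if_pos (by omega), dfact_eval_eq_zero_iff (evH₂ a)]
      omega

end
end

section
/- For every integer n ≥ 1 and every d = (d₁,d₂) ∈ ℤ², the vanishing ideal in ℂ[θ₁,θ₂] of the set {a ∈ S_n : a + d ∉ JMon_n} is the principal ideal generated by ∏_{i ∈ {1,2} with h_i(d) ≤ 0} (H_i, h_i(−d))!, where the product is over those indices i for which h_i(d) ≤ 0 and an empty product is 1. (This set describes the graded piece D(R_{A_n}, J)_d of the operators sending R_{A_n} into J.) -/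
open MvPolynomial

noncomputable section

/-- If `g i` generates the kernel of `φ i` and `φ i` does not kill `g j` for `j ≠ i`, then the
product of the `g i` generates the intersection of the kernels. -/
theorem prod_dvd_iff_forall_map_eq_zero {ι R A : Type*} [CommRing R] [CommRing A] [IsDomain A]
    (φ : ι → R →+* A) (g : ι → R) (hg : ∀ i f, g i ∣ f ↔ φ i f = 0)
    (hne : ∀ i j, i ≠ j → φ i (g j) ≠ 0) (s : Finset ι) (f : R) :
    ∏ i ∈ s, g i ∣ f ↔ ∀ i ∈ s, φ i f = 0 := by
  classical
  refine ⟨fun h i hi => (hg i f).1 ((Finset.dvd_prod_of_mem g hi).trans h), ?_⟩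
  induction s using Finset.induction_on generalizing f with
  | empty => simp
  | insert j s hj ih =>
    intro h
    obtain ⟨q, rfl⟩ := (hg j f).2 (h j (Finset.mem_insert_self j s))
    rw [Finset.prod_insert hj]
    refine mul_dvd_mul_left _ (ih q fun i hi => ?_)
    have hi' := h i (Finset.mem_insert_of_mem hi)
    rw [map_mul] at hi'
    exact (mul_eq_zero.1 hi').resolve_left (hne i j (ne_of_mem_of_not_mem hi hj))

/-- Restriction of a polynomial in `θ₁, θ₂` to the graph `θ₂ = p(θ₁)`. -/
def restrictGraph (p : Polynomial ℂ) : Cθ →ₐ[ℂ] Polynomial ℂ :=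
  aeval ![Polynomial.X, p]

theorem eval_restrictGraph (p : Polynomial ℂ) (f : Cθ) (x : ℂ) :
    (restrictGraph p f).eval x = eval ![x, p.eval x] f := by
  induction f using MvPolynomial.induction_on with
  | C a => simp [restrictGraph, Polynomial.algebraMap_eq]
  | add f g hf hg => simp [hf, hg]
  | mul_X f i hf =>
    rw [map_mul, map_mul, Polynomial.eval_mul, hf]
    fin_cases i <;> simp [restrictGraph]

/-- The equation of the graph `θ₂ = p(θ₁)` divides exactly the polynomials vanishing on it. -/
theorem graph_dvd_iff (p : Polynomial ℂ) (f : Cθ) :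
    X 1 - Polynomial.aeval (X 0) p ∣ f ↔ restrictGraph p f = 0 := by
  set L : Cθ := X 1 - Polynomial.aeval (X 0) p with hL
  constructor
  · rintro ⟨q, rfl⟩
    have : restrictGraph p L = 0 := by
      rw [hL, map_sub, ← Polynomial.aeval_algHom_apply]
      simp [restrictGraph]
    rw [map_mul, this, zero_mul]
  · intro h
    have key : (Ideal.Quotient.mkₐ ℂ (Ideal.span {L})).comp
        ((Polynomial.aeval (X 0 : Cθ)).comp (restrictGraph p)) =
        Ideal.Quotient.mkₐ ℂ (Ideal.span {L}) := by
      refine MvPolynomial.algHom_ext fun i => ?_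
      fin_cases i
      · simp [restrictGraph]
      · simpa [restrictGraph] using
          (Ideal.Quotient.eq.2 (Ideal.mem_span_singleton_self L)).symm
    have hf := DFunLike.congr_fun key f
    simp only [AlgHom.comp_apply, h, map_zero, Ideal.Quotient.mkₐ_eq_mk] at hf
    exact Ideal.mem_span_singleton.1 (Ideal.Quotient.eq_zero_iff_mem.1 hf.symm)

theorem eq_zero_of_eval_int_eq_zero (q : Polynomial ℂ) (m : ℤ)
    (h : ∀ x : ℤ, m ≤ x → q.eval (x : ℂ) = 0) : q = 0 := by
  refine Polynomial.eq_zero_of_infinite_isRoot q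
    (((Set.Ici_infinite m).image (Int.cast_injective (α := ℂ)).injOn).mono ?_)
  rintro _ ⟨x, hx, rfl⟩
  exact h x hx

/-- The lines `H₁ = j` and `H₂ = j`, as graphs over the first coordinate. -/
def levelLine (n : ℤ) : ℕ ⊕ ℕ → Polynomial ℂ :=
  Sum.elim (fun j => Polynomial.C (j : ℂ))
    fun j => Polynomial.C (n : ℂ) * Polynomial.X - Polynomial.C (j : ℂ)

/-- The equations `H₁ - j` and `H₂ - j`. -/
def levelEquation (n : ℤ) : ℕ ⊕ ℕ → Cθ :=
  Sum.elim (fun j => X 1 - C (j : ℂ)) fun j => C (n : ℂ) * X 0 - X 1 - C (j : ℂ)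

theorem levelEquation_dvd_iff (n : ℤ) (i : ℕ ⊕ ℕ) (f : Cθ) :
    levelEquation n i ∣ f ↔ restrictGraph (levelLine n i) f = 0 := by
  rw [← graph_dvd_iff]
  rcases i with j | j
  · simp [levelEquation, levelLine]
  · rw [← neg_dvd]
    simp only [levelEquation, levelLine, Sum.elim_inr, map_sub, map_mul, Polynomial.aeval_C,
      Polynomial.aeval_X, MvPolynomial.algebraMap_eq]
    ring_nf

theorem restrictGraph_levelEquation_ne_zero {n : ℤ} (hn : n ≠ 0) (i j : ℕ ⊕ ℕ) (hij : i ≠ j) :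
    restrictGraph (levelLine n i) (levelEquation n j) ≠ 0 := by
  have hn' : (n : ℂ) ≠ 0 := Int.cast_ne_zero.2 hn
  intro h
  have h0 := congrArg (Polynomial.eval 0) h
  have h1 := congrArg (Polynomial.eval 1) h
  rw [eval_restrictGraph] at h0 h1
  rcases i with i | i <;> rcases j with j | j <;>
    simp [levelLine, levelEquation] at h0 h1 hij
  · exact hij (by exact_mod_cast sub_eq_zero.1 h0)
  · exact hn' (by linear_combination h1 - h0)
  · exact hn' (by linear_combination h1 - h0)
  · exact hij (by exact_mod_cast sub_eq_zero.1 h0)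

/-- A polynomial vanishes on `{a ∈ S_n : a + d ∉ JMon_n}` iff it vanishes on each of the lines
`H_i = j` with `0 ≤ j ≤ h_i(-d)`. -/
theorem mem_vanishingIdeal_iff {n : ℤ} (hn : 1 ≤ n) (d : ℤ × ℤ) (f : Cθ) :
    f ∈ vanishingIdeal {a | a ∈ Sset n ∧ a + d ∉ JMon n} ↔
      ∀ i ∈ (Finset.range (-d.2 + 1).toNat).disjSum
        (Finset.range (-(n * d.1 - d.2) + 1).toNat), restrictGraph (levelLine n i) f = 0 := by
  change (∀ a ∈ {a | a ∈ Sset n ∧ a + d ∉ JMon n},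
    eval ![(a.1 : ℂ), (a.2 : ℂ)] f = 0) ↔ _
  constructor
  · rintro h (j | j) hi <;>
      simp only [Finset.inl_mem_disjSum, Finset.inr_mem_disjSum, Finset.mem_range,
        Int.lt_toNat] at hi <;>
      refine eq_zero_of_eval_int_eq_zero _ j fun x hx => ?_ <;>
      rw [eval_restrictGraph] <;>
      have hnx : x ≤ n * x := by nlinarith
    · have := h (x, j) ⟨⟨by simp, by simp; omega⟩, fun hJ => by
        have := hJ.2.1
        simp only [Prod.snd_add] at this
        omega⟩
      simpa [levelLine] using this
    · have := h (x, n * x - j) ⟨⟨by simp; omega, by simp⟩, fun hJ => by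
        have := hJ.2.2
        simp only [Prod.snd_add, Prod.fst_add, mul_add] at this
        omega⟩
      simpa [levelLine] using this
  · rintro h ⟨x, y⟩ ⟨⟨hy, hxy⟩, hJ⟩
    simp only at hy hxy
    have hcases : y + d.2 ≤ 0 ∨ n * x - y + (n * d.1 - d.2) ≤ 0 := by
      by_contra! hc
      refine hJ ⟨⟨?_, ?_⟩, ?_, ?_⟩ <;>
        simp only [Prod.snd_add, Prod.fst_add, mul_add] <;> omega
    rcases hcases with hc | hc
    · have := congrArg (Polynomial.eval (x : ℂ)) (h (.inl y.toNat) (by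
        simp only [Finset.inl_mem_disjSum, Finset.mem_range]
        omega))
      rw [eval_restrictGraph] at this
      have hcast : ((y.toNat : ℕ) : ℂ) = (y : ℂ) := by
        exact_mod_cast congrArg (Int.cast (R := ℂ)) (Int.toNat_of_nonneg hy)
      simpa [levelLine, hcast] using this
    · have := congrArg (Polynomial.eval (x : ℂ)) (h (.inr (n * x - y).toNat) (by
        simp only [Finset.inr_mem_disjSum, Finset.mem_range]
        omega))
      rw [eval_restrictGraph] at this
      have hcast : (((n * x - y).toNat : ℕ) : ℂ) = n * x - y := by
        exact_mod_cast congrArg (Int.cast (R := ℂ))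
          (Int.toNat_of_nonneg (sub_nonneg.2 hxy))
      simpa [levelLine, hcast] using this

theorem dfact_of_neg (P : Cθ) {m : ℤ} (hm : m < 0) : dfact P m = 1 := by
  rw [dfact, Int.toNat_of_nonpos (by omega), Finset.range_zero, Finset.prod_empty]

/-- The graded piece `D(R_{A_n}, J)_d`: the vanishing ideal of
`{a ∈ S_n : a + d ∉ JMon_n}` is the principal ideal generated by
`∏_{i : h_i(d) ≤ 0} (H_i, h_i(−d))!` (empty product equal to `1`). -/
theorem statement3 (n : ℤ) (hn : 1 ≤ n) (d : ℤ × ℤ) :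
    vanishingIdeal {a | a ∈ Sset n ∧ a + d ∉ JMon n} =
      Ideal.span
        {(if d.2 ≤ 0 then dfact (X 1) (-d.2) else 1) *
          (if n * d.1 - d.2 ≤ 0 then
            dfact (C (n : ℂ) * X 0 - X 1) (-(n * d.1 - d.2)) else 1)} := by
  have h₁ : (if d.2 ≤ 0 then dfact (X 1) (-d.2) else 1) = dfact (X 1) (-d.2) :=
    ite_eq_left_iff.2 fun h => (dfact_of_neg _ (by omega)).symm
  have h₂ : (if n * d.1 - d.2 ≤ 0 then
      dfact (C (n : ℂ) * X 0 - X 1) (-(n * d.1 - d.2)) else 1) =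
      dfact (C (n : ℂ) * X 0 - X 1) (-(n * d.1 - d.2)) :=
    ite_eq_left_iff.2 fun h => (dfact_of_neg _ (by omega)).symm
  ext f
  rw [h₁, h₂, Ideal.mem_span_singleton, mem_vanishingIdeal_iff hn]
  have key := prod_dvd_iff_forall_map_eq_zero
    (fun i => (restrictGraph (levelLine n i) : Cθ →+* Polynomial ℂ)) (levelEquation n)
    (levelEquation_dvd_iff n) (restrictGraph_levelEquation_ne_zero (by omega))
    ((Finset.range (-d.2 + 1).toNat).disjSum
      (Finset.range (-(n * d.1 - d.2) + 1).toNat)) f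
  rw [Finset.prod_disjSum] at key
  exact key.symm

end
end

section
/- For every integer n ≥ 1 and every d ∈ ℤ², let I_II(d) denote the vanishing ideal in ℂ[θ₁,θ₂] of Ω(d) ∪ {a ∈ JMon_n : a + d ∉ JMon_n}, and let I_D(d) denote the vanishing ideal of {a ∈ S_n : a + d ∉ JMon_n}. Then I_D(d) ⊆ I_II(d), and equality I_D(d) = I_II(d) holds if and only if h₁(d) ≠ 0 and h₂(d) ≠ 0; equivalently, the inclusion is strict exactly when d lies on the line y = 0 or on the line y = n·x. (Hence the quotient II(J)/D(R_{A_n},J) is concentrated in the degrees on the two facet lines.) -/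
open MvPolynomial

noncomputable section

/-- `I_II(d)`: the vanishing ideal of `Ω(d) ∪ {a ∈ JMon_n : a + d ∉ JMon_n}`,
describing the idealizer piece `II(J)_d`. -/
def idealII (n : ℤ) (d : ℤ × ℤ) : Ideal Cθ :=
  vanishingIdeal (Omega n d ∪ {a | a ∈ JMon n ∧ a + d ∉ JMon n})

/-- `I_D(d)`: the vanishing ideal of `{a ∈ S_n : a + d ∉ JMon_n}`,
describing the piece `D(R_{A_n}, J)_d`. -/
def idealD (n : ℤ) (d : ℤ × ℤ) : Ideal Cθ :=
  vanishingIdeal {a | a ∈ Sset n ∧ a + d ∉ JMon n}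

theorem vanishingIdeal_anti {V W : Set (ℤ × ℤ)} (h : V ⊆ W) :
    vanishingIdeal W ≤ vanishingIdeal V :=
  fun _ hf a ha => hf a (h ha)

/-- A polynomial vanishing at all points `a + k • w`, `k ≥ 1`, of a ray also vanishes at its
origin `a`. -/
theorem eval_eq_zero_of_ray (f : Cθ) (a w : ℤ × ℤ)
    (h : ∀ k : ℕ, 1 ≤ k →
      eval ![((a.1 + k * w.1 : ℤ) : ℂ), ((a.2 + k * w.2 : ℤ) : ℂ)] f = 0) :
    eval ![(a.1 : ℂ), (a.2 : ℂ)] f = 0 := by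
  let g : Polynomial ℂ := aeval ![Polynomial.C (a.1 : ℂ) + Polynomial.X * Polynomial.C (w.1 : ℂ),
    Polynomial.C (a.2 : ℂ) + Polynomial.X * Polynomial.C (w.2 : ℂ)] f
  have hg (t : ℂ) : g.eval t = eval ![(a.1 : ℂ) + t * w.1, (a.2 : ℂ) + t * w.2] f := by
    have := MvPolynomial.map_aeval
      ![Polynomial.C (a.1 : ℂ) + Polynomial.X * Polynomial.C (w.1 : ℂ),
        Polynomial.C (a.2 : ℂ) + Polynomial.X * Polynomial.C (w.2 : ℂ)]
      (Polynomial.evalRingHom t) f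
    rw [Polynomial.coe_evalRingHom] at this
    rw [this, eval]
    congr 2
    · ext x
      simp
    · funext i
      fin_cases i <;> simp
  have hg0 : g = 0 := by
    refine Polynomial.eq_zero_of_infinite_isRoot g ?_
    refine Set.Infinite.mono ?_ (Set.infinite_range_of_injective
      (f := fun k : ℕ => ((k + 1 : ℕ) : ℂ)) fun k l hkl => by simpa using hkl)
    rintro _ ⟨k, rfl⟩
    have := h (k + 1) (by omega)
    rw [Set.mem_ofPred_eq, Polynomial.IsRoot, hg, ← this]
    push_cast
    rfl
  simpa [hg0] using (hg 0).symm

theorem eval_dfact (P : Cθ) (m : ℤ) (x : Fin 2 → ℂ) :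
    eval x (dfact P m) = ∏ j ∈ Finset.range (m + 1).toNat, (eval x P - j) := by
  simp [dfact, map_prod]

theorem eval_dfact_eq_zero_iff {P : Cθ} {m c : ℤ} {x : Fin 2 → ℂ} (hc : eval x P = c) :
    eval x (dfact P m) = 0 ↔ 0 ≤ c ∧ c ≤ m := by
  rw [eval_dfact, Finset.prod_eq_zero_iff, hc]
  constructor
  · rintro ⟨j, hj, h⟩
    have : c = j := by exact_mod_cast sub_eq_zero.mp h
    rw [Finset.mem_range] at hj
    omega
  · rintro ⟨h0, hm⟩
    refine ⟨c.toNat, by rw [Finset.mem_range]; omega, ?_⟩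
    rw [sub_eq_zero]
    exact_mod_cast (Int.toNat_of_nonneg h0).symm

theorem idealD_le_idealII (n : ℤ) (d : ℤ × ℤ) : idealD n d ≤ idealII n d := by
  refine vanishingIdeal_anti ?_
  rintro a (⟨h, h'⟩ | ⟨h, h'⟩)
  · exact ⟨h, fun hJ => h' hJ.1⟩
  · exact ⟨h.1, h'⟩

theorem idealII_le_idealD {n : ℤ} (hn : 1 ≤ n) {d : ℤ × ℤ} (h₁ : d.2 ≠ 0)
    (h₂ : n * d.1 - d.2 ≠ 0) : idealII n d ≤ idealD n d := by
  rintro f hf a ⟨haS, haJ⟩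
  obtain ⟨x, y⟩ := a
  obtain ⟨u, v⟩ := d
  by_cases hII : (x, y) ∈ Omega n (u, v) ∪ {a | a ∈ JMon n ∧ a + (u, v) ∉ JMon n}
  · exact hf _ hII
  have key : (y = 0 ∧ n * x - y + (n * u - v) = 0) ∨ (n * x - y = 0 ∧ y + v = 0) := by
    simp only [Omega, JMon, Sset, Set.mem_union, Set.mem_ofPred_eq, Prod.mk_add_mk, mul_add]
      at haS haJ hII h₁ h₂
    grind
  simp only [Sset, Set.mem_ofPred_eq] at haS h₁ h₂
  rcases key with ⟨hy, hq⟩ | ⟨hq, hp⟩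
  · refine eval_eq_zero_of_ray f (x, y) (1, n) fun k hk => hf (x + k * 1, y + k * n) (Or.inr ?_)
    have : 0 < (k : ℤ) * n := by positivity
    simp only [JMon, Sset, Set.mem_ofPred_eq, Prod.mk_add_mk, mul_add, mul_one, mul_comm n (k : ℤ)]
    omega
  · refine eval_eq_zero_of_ray f (x, y) (1, 0) fun k hk => hf (x + k * 1, y + k * 0) (Or.inr ?_)
    have : 0 < (k : ℤ) * n := by positivity
    simp only [JMon, Sset, Set.mem_ofPred_eq, Prod.mk_add_mk, mul_add, mul_one, mul_zero,
      mul_comm n (k : ℤ)]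
    omega

theorem not_idealII_le_idealD_of_snd_eq_zero {n : ℤ} (hn : 1 ≤ n) {d : ℤ × ℤ} (h : d.2 = 0) :
    ¬ idealII n d ≤ idealD n d := by
  obtain ⟨u, v⟩ := d
  obtain rfl : v = 0 := h
  intro hle
  have heval (x y : ℤ) : eval ![(x : ℂ), (y : ℂ)] (C (n : ℂ) * X 0 - X 1 : Cθ) =
      ((n * x - y : ℤ) : ℂ) := by simp
  have hmem : dfact (C (n : ℂ) * X 0 - X 1) (-(n * u)) ∈ idealII n (u, 0) := by
    rintro ⟨x, y⟩ ha
    refine (eval_dfact_eq_zero_iff (heval x y)).2 ?_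
    simp only [Omega, JMon, Sset, Set.mem_union, Set.mem_ofPred_eq, Prod.mk_add_mk, mul_add] at ha
    omega
  have hx : 0 ≤ n * (|u| + 1) := by positivity
  have hz := hle hmem (|u| + 1, 0) (by simpa [JMon, Sset] using hx)
  have := (eval_dfact_eq_zero_iff (heval _ _)).1 hz
  nlinarith [neg_abs_le u]

theorem not_idealII_le_idealD_of_snd_eq_mul {n : ℤ} (hn : 1 ≤ n) {d : ℤ × ℤ}
    (h : d.2 = n * d.1) : ¬ idealII n d ≤ idealD n d := by
  obtain ⟨u, v⟩ := d
  obtain rfl : v = n * u := h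
  intro hle
  have heval (x y : ℤ) : eval ![(x : ℂ), (y : ℂ)] (X 1 : Cθ) = (y : ℂ) := by simp
  have hmem : dfact (X 1) (-(n * u)) ∈ idealII n (u, n * u) := by
    rintro ⟨x, y⟩ ha
    refine (eval_dfact_eq_zero_iff (heval x y)).2 ?_
    simp only [Omega, JMon, Sset, Set.mem_union, Set.mem_ofPred_eq, Prod.mk_add_mk, mul_add] at ha
    omega
  have hx : 0 ≤ n * (|u| + 1) := by positivity
  have hz := hle hmem (|u| + 1, n * (|u| + 1)) (by simpa [JMon, Sset, mul_add] using hx)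
  have := (eval_dfact_eq_zero_iff (heval _ _)).1 hz
  nlinarith [neg_abs_le u]

/-- `I_D(d) ⊆ I_II(d)` always, with equality iff `h₁(d) ≠ 0` and `h₂(d) ≠ 0`;
equivalently, the inclusion is strict exactly when `d` lies on `y = 0` or `y = n x`. -/
theorem statement4 (n : ℤ) (hn : 1 ≤ n) (d : ℤ × ℤ) :
    idealD n d ≤ idealII n d ∧
      (idealD n d = idealII n d ↔ d.2 ≠ 0 ∧ n * d.1 - d.2 ≠ 0) ∧
      (idealD n d < idealII n d ↔ d.2 = 0 ∨ d.2 = n * d.1) := by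
  have hle := idealD_le_idealII n d
  have key : idealII n d ≤ idealD n d ↔ d.2 ≠ 0 ∧ n * d.1 - d.2 ≠ 0 := by
    refine ⟨fun h => ⟨fun h₁ => not_idealII_le_idealD_of_snd_eq_zero hn h₁ h,
      fun h₂ => not_idealII_le_idealD_of_snd_eq_mul hn (by linarith) h⟩,
      fun h => idealII_le_idealD hn h.1 h.2⟩
  refine ⟨hle, ?_, ?_⟩
  · rw [← key]
    exact ⟨fun h => h.ge, hle.antisymm⟩
  · rw [lt_iff_le_not_ge, key]
    simp only [hle, true_and, ne_eq, not_and_or, not_not, sub_eq_zero, eq_comm]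

end
end

section
/- Let n = 2. For every d ∈ ℤ², the ideal of ℂ[θ₁,θ₂] given by the sum Σ_{m ∈ JMon₂} I(Ω(d − m)) of the vanishing ideals of the sets Ω(d − m) over all m ∈ JMon₂ equals the vanishing ideal of {a ∈ S₂ : a + d ∉ JMon₂}. (This expresses the equality JD(R_{A₂}) = D(R_{A₂}, J) in every multidegree for the rational normal curve of degree 2.) -/
open MvPolynomial

noncomputable section

/-- The interior of the semigroup `S₂` is the translate of `S₂` by `(1, 1)`. -/
theorem mem_JMon_two_iff (a : ℤ × ℤ) : a ∈ JMon 2 ↔ a - (1, 1) ∈ Sset 2 := by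
  simp only [JMon, Sset, Set.mem_ofPred_eq, Prod.fst_sub, Prod.snd_sub]
  omega

theorem add_mem_JMon_two {a m : ℤ × ℤ} (ha : a ∈ Sset 2) (hm : m ∈ JMon 2) :
    a + m ∈ JMon 2 := by
  simp only [JMon, Sset, Set.mem_ofPred_eq, Prod.fst_add, Prod.snd_add] at *
  omega

/-- For the rational normal curve of degree `2`, in every multidegree `d` the sum
`Σ_{m ∈ JMon₂} I(Ω(d − m))` equals the vanishing ideal of `{a ∈ S₂ : a + d ∉ JMon₂}`;
that is, `J D(R_{A₂}) = D(R_{A₂}, J)`. -/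
theorem statement5 (d : ℤ × ℤ) :
    (⨆ m ∈ JMon 2, vanishingIdeal (Omega 2 (d - m))) =
      vanishingIdeal {a | a ∈ Sset 2 ∧ a + d ∉ JMon 2} := by
  apply le_antisymm
  · refine iSup₂_le fun m hm => vanishingIdeal_anti fun a ha => ⟨ha.1, fun h => ha.2 ?_⟩
    have := add_mem_JMon_two h hm
    rwa [add_assoc, sub_add_cancel] at this
  · have hm : ((1, 1) : ℤ × ℤ) ∈ JMon 2 := by simp [JMon, Sset]
    refine le_trans (vanishingIdeal_anti fun a ha => ⟨ha.1, fun h => ha.2 ?_⟩)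
      (le_iSup₂ (f := fun m _ => vanishingIdeal (Omega 2 (d - m))) (1, 1) hm)
    rwa [mem_JMon_two_iff, add_sub_assoc] at h

end
end

section
/- Let S̃ = ℕ² \ {(1,0)} ⊆ ℤ² and J̃Mon = {(a,b) ∈ ℤ² : a ≥ 1 and b ≥ 1}. For every d = (d₁, 0) ∈ ℤ² with d₁ ≤ −1, the vanishing ideal in ℂ[θ₁,θ₂] of the set Ω̃(d) ∪ {a ∈ J̃Mon : a + d ∉ J̃Mon} equals the ideal generated by the two polynomials (∏_{i=0}^{−d₁}(θ₁ − i)) · (θ₁ + d₁ − 1) and (∏_{i=0}^{−d₁}(θ₁ − i)) · θ₂. (This computes the graded pieces of the idealizer II(J̃) along the negative of the facet σ₂, where it is not principal.) -/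
open MvPolynomial

noncomputable section

/-- `S̃ = ℕ² \ {(1, 0)}`, the exponent set of the non-normal affine semigroup ring
`R_Ã = ℂ[st, s², s³, t]`. -/
def Stilde : Set (ℤ × ℤ) := {a | 0 ≤ a.1 ∧ 0 ≤ a.2 ∧ a ≠ (1, 0)}

/-- `J̃Mon = {(a, b) : a ≥ 1, b ≥ 1}`, the exponents of monomials of `J̃ = ⟨st, s²t⟩`. -/
def JtMon : Set (ℤ × ℤ) := {a | 1 ≤ a.1 ∧ 1 ≤ a.2}

/-- `Ω̃(d) = {a ∈ S̃ : a + d ∉ S̃}`. -/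
def Omegat (d : ℤ × ℤ) : Set (ℤ × ℤ) := {a | a ∈ Stilde ∧ a + d ∉ Stilde}

theorem sub_aeval_mem {σ R : Type*} [CommRing R] (I : Ideal (MvPolynomial σ R))
    (s : σ → MvPolynomial σ R) (hs : ∀ i, X i - s i ∈ I) (f : MvPolynomial σ R) :
    f - aeval s f ∈ I := by
  have key : Ideal.Quotient.mkₐ R I = (Ideal.Quotient.mkₐ R I).comp (aeval s) := by
    ext i
    simpa using Ideal.Quotient.eq.mpr (hs i)
  exact Ideal.Quotient.eq.mp (DFunLike.congr_fun key f)

/-- A polynomial vanishing at all points `(c, y)` with `y ≥ 1` an integer is divisible by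
`θ₁ - c`. -/
theorem X_sub_C_dvd_of_eval_eq_zero (c : ℂ) (f : Cθ)
    (hf : ∀ y : ℤ, 1 ≤ y → eval ![c, (y : ℂ)] f = 0) : X 0 - C c ∣ f := by
  let p : Polynomial ℂ := aeval ![Polynomial.C c, Polynomial.X] f
  have hp_eval (y : ℂ) : p.eval y = eval ![c, y] f := by
    have : (Polynomial.aeval y).comp (aeval ![Polynomial.C c, Polynomial.X]) =
        aeval (R := ℂ) ![c, y] := by
      ext i
      fin_cases i <;> simp
    exact DFunLike.congr_fun this f
  have hp : p = 0 := by
    refine Polynomial.eq_zero_of_infinite_isRoot p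
      (((Set.Ici_infinite (1 : ℤ)).image Int.cast_injective.injOn).mono ?_)
    rintro _ ⟨y, hy, rfl⟩
    exact (hp_eval y).trans (hf y hy)
  have hsub : aeval ![C c, X 1] f = (0 : Cθ) := by
    have : (Polynomial.aeval (X 1 : Cθ)).comp (aeval ![Polynomial.C c, Polynomial.X]) =
        aeval (R := ℂ) ![C c, X 1] := by
      ext1 i
      fin_cases i <;> simp [algebraMap_eq]
    rw [← this, AlgHom.comp_apply]
    exact (congrArg _ hp).trans (map_zero _)
  have := sub_aeval_mem (Ideal.span {X 0 - C c}) ![C c, X 1] (fun i => by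
    fin_cases i <;> simp) f
  rwa [hsub, sub_zero, Ideal.mem_span_singleton] at this

theorem prod_X_sub_C_dvd_of_eval_eq_zero (f : Cθ) (n : ℕ)
    (hf : ∀ i < n, ∀ y : ℤ, 1 ≤ y → eval ![(i : ℂ), (y : ℂ)] f = 0) :
    ∏ i ∈ Finset.range n, (X 0 - C (i : ℂ)) ∣ f := by
  induction n with
  | zero => simp
  | succ n ih =>
    obtain ⟨g, rfl⟩ := ih fun i hi => hf i (by omega)
    rw [Finset.prod_range_succ]
    refine mul_dvd_mul_left _ (X_sub_C_dvd_of_eval_eq_zero _ _ fun y hy => ?_)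
    have h0 := hf n (by omega) y hy
    rw [map_mul, mul_eq_zero] at h0
    refine h0.resolve_left ?_
    simp only [map_prod, map_sub, eval_X, eval_C, Matrix.cons_val_zero, Finset.prod_ne_zero_iff,
      Finset.mem_range, sub_ne_zero]
    intro i hi
    exact_mod_cast hi.ne'

theorem mem_span_X_sub_C_X_of_eval_eq_zero (c : ℂ) (g : Cθ) (hg : eval ![c, 0] g = 0) :
    g ∈ Ideal.span {X 0 - C c, X 1} := by
  have h0 : aeval ![C c, 0] g = (0 : Cθ) := by
    have : (Algebra.ofId ℂ Cθ).comp (aeval ![c, 0]) = aeval (R := ℂ) ![C c, 0] := by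
      ext1 i
      fin_cases i <;> simp [Algebra.ofId_apply, algebraMap_eq]
    rw [← this, AlgHom.comp_apply]
    exact (congrArg _ hg).trans (map_zero _)
  have := sub_aeval_mem (Ideal.span {X 0 - C c, X 1}) ![C c, 0] (fun i => by
    fin_cases i
    · exact Ideal.subset_span (by simp)
    · exact Ideal.subset_span (by simp)) g
  rwa [h0, sub_zero] at this

theorem eval_prod_X_sub_C_eq_zero {n : ℕ} {x : ℤ} (h0 : 0 ≤ x) (hx : x < n) (y : ℂ) :
    eval ![(x : ℂ), y] (∏ i ∈ Finset.range n, (X 0 - C (i : ℂ))) = 0 := by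
  lift x to ℕ using h0
  rw [map_prod]
  exact Finset.prod_eq_zero (Finset.mem_range.mpr (by exact_mod_cast hx)) (by simp)

/-- Along the negative of the facet σ₂, i.e. for `d = (d₁, 0)` with `d₁ ≤ −1`, the
idealizer piece `II(J̃)_d`, namely the vanishing ideal of
`Ω̃(d) ∪ {a ∈ J̃Mon : a + d ∉ J̃Mon}`, is generated by the two polynomials
`(∏_{i=0}^{−d₁}(θ₁ − i))·(θ₁ + d₁ − 1)` and `(∏_{i=0}^{−d₁}(θ₁ − i))·θ₂`;
in particular it is not principal. -/
theorem statement12 (d1 : ℤ) (h : d1 ≤ -1) :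
    vanishingIdeal
        (Omegat (d1, 0) ∪ {a | a ∈ JtMon ∧ a + (d1, 0) ∉ JtMon}) =
      Ideal.span
        {(∏ i ∈ Finset.range (-d1 + 1).toNat, (X 0 - C (i : ℂ))) *
            (X 0 + C (d1 : ℂ) - 1),
          (∏ i ∈ Finset.range (-d1 + 1).toNat, (X 0 - C (i : ℂ))) * X 1} := by
  apply le_antisymm
  · intro f hf
    have hf (x y : ℤ) (hxy : (x, y) ∈
        Omegat (d1, 0) ∪ {a | a ∈ JtMon ∧ a + (d1, 0) ∉ JtMon}) :
        eval ![(x : ℂ), (y : ℂ)] f = 0 := hf (x, y) hxy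
    simp only [Omegat, Stilde, JtMon, Set.mem_union, Set.mem_ofPred_eq, Prod.mk_add_mk, ne_eq,
      Prod.mk.injEq] at hf
    obtain ⟨g, rfl⟩ := prod_X_sub_C_dvd_of_eval_eq_zero f (-d1 + 1).toNat fun i hi y hy => by
      exact_mod_cast hf i y (by omega)
    have hg : eval ![((1 - d1 : ℤ) : ℂ), 0] g = 0 := by
      have h0 := hf (1 - d1) 0 (by omega)
      rw [map_mul, mul_eq_zero, Int.cast_zero] at h0
      refine h0.resolve_left ?_
      simp only [map_prod, map_sub, eval_X, eval_C, Matrix.cons_val_zero,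
        Finset.prod_ne_zero_iff, Finset.mem_range, sub_ne_zero]
      intro i hi
      have : 1 - d1 ≠ i := by omega
      exact_mod_cast this
    obtain ⟨a, b, rfl⟩ := Ideal.mem_span_pair.mp (mem_span_X_sub_C_X_of_eval_eq_zero _ g hg)
    refine Ideal.mem_span_pair.mpr ⟨a, b, ?_⟩
    push_cast
    rw [map_sub, map_one]
    ring
  · rw [Ideal.span_le]
    have hcase {x y : ℤ} (hxy : (x, y) ∈
        Omegat (d1, 0) ∪ {a | a ∈ JtMon ∧ a + (d1, 0) ∉ JtMon}) :
        (0 ≤ x ∧ x < (-d1 + 1).toNat) ∨ (x = 1 - d1 ∧ y = 0) := by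
      simp only [Omegat, Stilde, JtMon, Set.mem_union, Set.mem_ofPred_eq, Prod.mk_add_mk, ne_eq,
        Prod.mk.injEq] at hxy
      omega
    rintro _ (rfl | rfl) ⟨x, y⟩ hxy <;> rw [map_mul] <;>
      obtain ⟨h0, hx⟩ | ⟨rfl, rfl⟩ := hcase hxy
    · rw [eval_prod_X_sub_C_eq_zero h0 hx, zero_mul]
    · simp
    · rw [eval_prod_X_sub_C_eq_zero h0 hx, zero_mul]
    · simp

end
end

section
/- Let Γ = ℕ \ {1} and S = {(a,b) ∈ ℤ² : a ∈ Γ and b ≥ 0}. For every d = (d₁,d₂) ∈ ℤ², the set Ω_Γ(d₁) = {γ ∈ Γ : γ + d₁ ∉ Γ} is finite, and the vanishing ideal in ℂ[θ₁,θ₂] of Ω(d) = {a ∈ S : a + d ∉ S} is the principal ideal generated by (∏_{γ ∈ Ω_Γ(d₁)}(θ₁ − γ)) · (∏_{j=0}^{−d₂−1}(θ₂ − j)), where an empty product is 1. (This computes the multigraded pieces of the ring of differential operators of the non-normal semigroup ring ℂ[s²,s³,t].) -/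
open MvPolynomial

noncomputable section

/-- `Γ = ℕ \ {1} ⊆ ℤ`, the numerical semigroup generated by `2` and `3`. -/
def Gam : Set ℤ := {a | 0 ≤ a ∧ a ≠ 1}

/-- `S = Γ × ℕ ⊆ ℤ²`, the exponent set of the non-normal affine semigroup ring
`R_A = ℂ[s², s³, t]`. -/
def SsetG : Set (ℤ × ℤ) := {a | a.1 ∈ Gam ∧ 0 ≤ a.2}

/-- `Ω(d) = {a ∈ S : a + d ∉ S}`. -/
def OmegaG (d : ℤ × ℤ) : Set (ℤ × ℤ) := {a | a ∈ SsetG ∧ a + d ∉ SsetG}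

/-- `JMon = {(a, b) : a ≥ 2, b ≥ 1}`, the exponents of monomials of the radical interior
ideal `J = ⟨s²t, s³t⟩` of `R_A`. -/
def JMonG : Set (ℤ × ℤ) := {a | 2 ≤ a.1 ∧ 1 ≤ a.2}

/-- `Ω_Γ(d₁) = {γ ∈ Γ : γ + d₁ ∉ Γ}`. -/
def OmegaGam (d1 : ℤ) : Set ℤ := {g | g ∈ Gam ∧ g + d1 ∉ Gam}

/-- A polynomial vanishing at the points of the hyperplane `x i = c` whose remaining coordinates
lie in a fixed infinite set is divisible by `X i - c`. -/
theorem X_sub_C_dvd_of_eval_eq_zero_s15 {σ R : Type*} [CommRing R] [IsDomain R]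
    (i : σ) (c : R) {s : Set R} (hs : s.Infinite) (f : MvPolynomial σ R)
    (h : ∀ x : σ → R, x i = c → (∀ k, k ≠ i → x k ∈ s) → eval x f = 0) :
    X i - C c ∣ f := by
  classical
  set φ : MvPolynomial σ R →ₐ[R] MvPolynomial σ R := aeval (Function.update X i (C c))
  have hφ : φ f = 0 := by
    refine funext_set (fun _ => s) (fun _ => hs) fun x hx => ?_
    have hcomp : eval x (φ f) = eval (Function.update x i c) f := by
      rw [← coe_aeval_eq_eval, ← coe_aeval_eq_eval, RingHom.coe_coe, RingHom.coe_coe,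
        ← AlgHom.comp_apply]
      congr 1
      ext k
      by_cases hk : k = i
      · subst hk; simp [φ]
      · simp [φ, hk]
    rw [hcomp, map_zero]
    refine h _ (by simp) fun k hk => ?_
    simpa [hk] using hx k (Set.mem_univ k)
  let q := Ideal.Quotient.mkₐ R (Ideal.span {(X i - C c : MvPolynomial σ R)})
  have hq : q.comp φ = q := by
    ext k
    by_cases hk : k = i
    · subst hk
      simp only [φ, q, AlgHom.comp_apply, aeval_X, Function.update_self,
        Ideal.Quotient.mkₐ_eq_mk]
      rw [eq_comm, Ideal.Quotient.eq]
      exact Ideal.mem_span_singleton_self _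
    · simp [φ, hk]
  have hf : q f = 0 := by
    rw [← hq, AlgHom.comp_apply, hφ, map_zero]
  rwa [Ideal.Quotient.mkₐ_eq_mk, Ideal.Quotient.eq_zero_iff_mem,
    Ideal.mem_span_singleton] at hf

/-- Distinct linear factors in the same variable that divide `f` have a product dividing `f`. -/
theorem prod_X_sub_C_dvd {σ K ι : Type*} [Field K] (i : σ) {u : ι → K}
    (hu : Function.Injective u) (t : Finset ι) {f : MvPolynomial σ K}
    (h : ∀ j ∈ t, X i - C (u j) ∣ f) : ∏ j ∈ t, (X i - C (u j)) ∣ f := by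
  refine Finset.prod_dvd_of_coprime (fun a _ b _ hab => ?_) h
  have hne : u b - u a ≠ 0 := sub_ne_zero.mpr fun e => hab (hu e).symm
  refine ⟨C (u b - u a)⁻¹, -C (u b - u a)⁻¹, ?_⟩
  have hC : (C (u b - u a)⁻¹ : MvPolynomial σ K) * (C (u b) - C (u a)) = 1 := by
    rw [← C_sub, ← C_mul, inv_mul_cancel₀ hne, C_1]
  linear_combination hC

theorem OmegaGam_finite (d1 : ℤ) : (OmegaGam d1).Finite := by
  refine (Set.finite_Icc 0 (1 - d1)).subset ?_
  rintro g ⟨⟨h0, -⟩, h⟩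
  simp only [Gam, Set.mem_ofPred_eq, not_and_or, not_le, not_not] at h
  exact ⟨h0, by omega⟩

theorem Gam_infinite : Gam.Infinite := by
  refine (Set.Ici_infinite (2 : ℤ)).mono fun a ha => ?_
  have : 2 ≤ a := ha
  exact ⟨by omega, by omega⟩

theorem eval_dfact_eq_zero_s15 {a d2 : ℤ} (ha : 0 ≤ a) (had : a + d2 < 0) (P : Cθ) {x : Fin 2 → ℂ}
    (hP : eval x P = a) : eval x (dfact P (-d2 - 1)) = 0 := by
  rw [dfact, map_prod]
  refine Finset.prod_eq_zero (i := a.toNat) (Finset.mem_range.mpr (by omega)) ?_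
  have hcast : ((a.toNat : ℕ) : ℂ) = (a : ℂ) := by
    exact_mod_cast congrArg (Int.cast : ℤ → ℂ) (Int.toNat_of_nonneg ha)
  simp [hP, hcast]

/-- For every `d ∈ ℤ²`, the set `Ω_Γ(d₁)` is finite and the vanishing ideal of `Ω(d)` is
the principal ideal generated by `(∏_{γ ∈ Ω_Γ(d₁)} (θ₁ − γ)) · (∏_{j=0}^{−d₂−1} (θ₂ − j))`
(empty products equal to `1`); this computes the multigraded pieces of the ring of
differential operators of `ℂ[s², s³, t]`. -/
theorem statement15 (d : ℤ × ℤ) :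
    ∃ hfin : (OmegaGam d.1).Finite,
      vanishingIdeal (OmegaG d) =
        Ideal.span
          {(∏ g ∈ hfin.toFinset, (X 0 - C (g : ℂ))) * dfact (X 1) (-d.2 - 1)} := by
  refine ⟨OmegaGam_finite d.1, le_antisymm (fun f hf => ?_) ?_⟩
  · have hf' : ∀ a ∈ OmegaG d, eval ![(a.1 : ℂ), (a.2 : ℂ)] f = 0 := hf
    rw [Ideal.mem_span_singleton]
    have hleft : ∏ g ∈ (OmegaGam_finite d.1).toFinset, (X 0 - C (g : ℂ)) ∣ f := by
      refine prod_X_sub_C_dvd 0 Int.cast_injective _ fun g hg => ?_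
      obtain ⟨hgΓ, hgd⟩ := (Set.Finite.mem_toFinset _).mp hg
      refine X_sub_C_dvd_of_eval_eq_zero_s15 0 _
        ((Set.Ici_infinite (0 : ℤ)).image Int.cast_injective.injOn) f fun x hx0 hx => ?_
      obtain ⟨b, hb, hbx⟩ := hx 1 (by decide)
      have hx' : x = ![(g : ℂ), (b : ℂ)] := by
        ext k; fin_cases k <;> simp [hx0, hbx]
      rw [hx']
      exact hf' (g, b) ⟨⟨hgΓ, hb⟩, fun h => hgd h.1⟩
    obtain ⟨h, rfl⟩ := hleft
    refine mul_dvd_mul_left _ ?_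
    rw [dfact]
    refine prod_X_sub_C_dvd 1 Nat.cast_injective _ fun j hj => ?_
    refine X_sub_C_dvd_of_eval_eq_zero_s15 1 _
      ((Gam_infinite.sdiff (OmegaGam_finite d.1)).image Int.cast_injective.injOn) h
      fun x hx1 hx => ?_
    obtain ⟨g, ⟨hgΓ, hgΩ⟩, hgx⟩ := hx 0 (by decide)
    have hx' : x = ![(g : ℂ), ((j : ℤ) : ℂ)] := by
      ext k; fin_cases k <;> simp [hx1, hgx]
    have hj' := Finset.mem_range.mp hj
    have hzero := hf' (g, (j : ℤ)) ⟨⟨hgΓ, by simp⟩, fun hS => by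
      have h2 : 0 ≤ (j : ℤ) + d.2 := hS.2
      omega⟩
    rw [map_mul, map_prod] at hzero
    rw [hx']
    refine (mul_eq_zero.mp hzero).resolve_left (Finset.prod_ne_zero_iff.mpr fun a ha => ?_)
    have hga : g ≠ a := fun e => hgΩ (e ▸ (Set.Finite.mem_toFinset _).mp ha)
    simpa [sub_eq_zero] using hga
  · rw [Ideal.span_singleton_le_iff_mem]
    rintro a ⟨⟨haΓ, ha2⟩, had⟩
    rw [map_mul, mul_eq_zero]
    by_cases h1 : a.1 + d.1 ∈ Gam
    · right
      have h2 : a.2 + d.2 < 0 := lt_of_not_ge fun h => had ⟨h1, h⟩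
      exact eval_dfact_eq_zero_s15 ha2 h2 _ (by simp)
    · left
      rw [map_prod]
      exact Finset.prod_eq_zero (i := a.1) ((Set.Finite.mem_toFinset _).mpr ⟨haΓ, h1⟩) (by simp)

end
end

section
/- Let Γ = ℕ \ {1}, S = {(a,b) ∈ ℤ² : a ∈ Γ and b ≥ 0}, and JMon = {(a,b) ∈ ℤ² : a ≥ 2 and b ≥ 1}. For every d = (d₁,d₂) ∈ ℤ², the vanishing ideal in ℂ[θ₁,θ₂] of the set {a ∈ S : a + d ∉ JMon} is the principal ideal generated by (∏_{i ∈ ℕ, i ≤ 1−d₁, i ≠ 1}(θ₁ − i)) · (∏_{j=0}^{−d₂}(θ₂ − j)), where an empty product is 1. (This computes all graded pieces of D(R_A, J) for the non-normal ring R_A = ℂ[s²,s³,t] with J = ⟨s²t, s³t⟩.) -/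
open MvPolynomial

noncomputable section

/-- If `f` vanishes at all points whose `k`-th coordinate is `c` and whose other coordinates lie
in an infinite set, then `X k - C c` divides `f`. -/
theorem X_sub_C_dvd_of_eval_eq_zero_s16 {σ K : Type*} [DecidableEq σ] [Field K] (k : σ) (c : K)
    {T : Set K} (hT : T.Infinite) (f : MvPolynomial σ K)
    (hf : ∀ x : σ → K, x k = c → (∀ j, j ≠ k → x j ∈ T) → eval x f = 0) :
    X k - C c ∣ f := by
  have hzero : bind₁ (Function.update X k (C c)) f = 0 := by
    refine funext_set (fun _ => T) (fun _ => hT) fun x hx => ?_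
    have hcomp : (fun i => eval x (Function.update X k (C c) i)) = Function.update x k c := by
      ext i
      by_cases hi : i = k
      · subst hi; simp
      · simp [hi]
    rw [map_zero, ← coe_aeval_eq_eval, RingHom.coe_coe, aeval_bind₁]
    simp only [← coe_aeval_eq_eval, RingHom.coe_coe] at hcomp hf
    rw [hcomp]
    refine hf _ (by simp) fun j hj => ?_
    simpa [hj] using hx j (Set.mem_univ j)
  have hmk : ((Ideal.Quotient.mkₐ K (Ideal.span {(X k - C c : MvPolynomial σ K)})).comp
      (bind₁ (Function.update X k (C c)))) = Ideal.Quotient.mkₐ K (Ideal.span {X k - C c}) := by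
    ext i
    by_cases hi : i = k
    · subst hi
      simp only [AlgHom.comp_apply, bind₁_X_right, Function.update_self, Ideal.Quotient.mkₐ_eq_mk]
      rw [eq_comm, Ideal.Quotient.eq]
      exact Ideal.mem_span_singleton_self _
    · simp [hi]
  have h := DFunLike.congr_fun hmk f
  rw [AlgHom.comp_apply, hzero, map_zero, Ideal.Quotient.mkₐ_eq_mk, eq_comm,
    Ideal.Quotient.eq_zero_iff_mem, Ideal.mem_span_singleton] at h
  exact h

theorem isCoprime_X_sub_C {σ K : Type*} [Field K] (k : σ) {a b : K} (hab : a ≠ b) :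
    IsCoprime (X k - C a : MvPolynomial σ K) (X k - C b) := by
  have hC : (C (b - a)⁻¹ : MvPolynomial σ K) * (C b - C a) = 1 := by
    rw [← C_sub, ← C_mul, inv_mul_cancel₀ (sub_ne_zero.2 hab.symm), C_1]
  exact ⟨C (b - a)⁻¹, -C (b - a)⁻¹, by linear_combination hC⟩

/-- If `f` vanishes at all points whose `k`-th coordinate lies in `A` and whose other coordinates
lie in an infinite set, then `∏ i ∈ A, (X k - C i)` divides `f`. -/
theorem prod_X_sub_C_dvd_of_eval_eq_zero_s16 {σ K : Type*} [DecidableEq σ] [Field K] [CharZero K]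
    (k : σ) (A : Finset ℕ) {T : Set K} (hT : T.Infinite) (f : MvPolynomial σ K)
    (hf : ∀ i ∈ A, ∀ x : σ → K, x k = i → (∀ j, j ≠ k → x j ∈ T) → eval x f = 0) :
    ∏ i ∈ A, (X k - C (i : K)) ∣ f := by
  refine Finset.prod_dvd_of_coprime ?_ ?_
  · intro i _ j _ hij
    have hij' : (i : K) ≠ j := Nat.cast_injective.ne hij
    exact isCoprime_X_sub_C k hij'
  · intro i hi
    exact X_sub_C_dvd_of_eval_eq_zero_s16 k (i : K) hT f (hf i hi)

theorem infinite_natCast_image_compl (A : Finset ℕ) :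
    ((fun n : ℕ => (n : ℂ)) '' {n | n ∉ A}).Infinite :=
  A.finite_toSet.infinite_compl.image Nat.cast_injective.injOn

theorem eval_prod_X_sub_C_eq_zero_iff {σ : Type*} (k : σ) (A : Finset ℕ) (x : σ → ℂ) {n : ℕ}
    (hx : x k = n) : eval x (∏ i ∈ A, (X k - C (i : ℂ))) = 0 ↔ n ∈ A := by
  simp [Finset.prod_eq_zero_iff, hx, sub_eq_zero]

/-- The vanishing ideal of the points of `(ℕ \ G) × ℕ` with first coordinate in `A` or second
coordinate in `B`. -/
theorem mem_span_prod_mul_prod_iff (A B G : Finset ℕ) (hAG : Disjoint A G) (f : Cθ) :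
    f ∈ Ideal.span {(∏ i ∈ A, (X 0 - C (i : ℂ))) * ∏ j ∈ B, (X 1 - C (j : ℂ))} ↔
      ∀ m n : ℕ, m ∉ G → (m ∈ A ∨ n ∈ B) → eval ![(m : ℂ), (n : ℂ)] f = 0 := by
  rw [Ideal.mem_span_singleton]
  constructor
  · rintro ⟨g, rfl⟩ m n - hmn
    have h₀ := eval_prod_X_sub_C_eq_zero_iff (0 : Fin 2) A ![(m : ℂ), (n : ℂ)] (n := m) rfl
    have h₁ := eval_prod_X_sub_C_eq_zero_iff (1 : Fin 2) B ![(m : ℂ), (n : ℂ)] (n := n) rfl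
    rw [map_mul, map_mul]
    rcases hmn with hm | hn
    · rw [h₀.2 hm, zero_mul, zero_mul]
    · rw [h₁.2 hn, mul_zero, zero_mul]
  · intro hf
    obtain ⟨g, rfl⟩ : ∏ i ∈ A, (X 0 - C (i : ℂ)) ∣ f := by
      refine prod_X_sub_C_dvd_of_eval_eq_zero_s16 0 A (infinite_natCast_image_compl ∅) f ?_
      intro i hi x hx hxT
      obtain ⟨n, -, hn⟩ := hxT 1 (by decide)
      have hxe : x = ![(i : ℂ), (n : ℂ)] := by
        ext j; fin_cases j <;> simp [hx, ← hn]
      rw [hxe]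
      exact hf i n (Finset.disjoint_left.1 hAG hi) (Or.inl hi)
    refine mul_dvd_mul_left _
      (prod_X_sub_C_dvd_of_eval_eq_zero_s16 1 B (infinite_natCast_image_compl (A ∪ G)) g ?_)
    intro j hj x hx hxT
    obtain ⟨m, hm, hmx⟩ := hxT 0 (by decide)
    rw [Set.mem_ofPred_eq, Finset.mem_union, not_or] at hm
    have hxe : x = ![(m : ℂ), (j : ℂ)] := by
      ext i; fin_cases i <;> simp [hx, ← hmx]
    have h := hf m j hm.2 (Or.inr hj)
    rw [map_mul, ← hxe, mul_eq_zero] at h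
    exact h.resolve_left fun h₀ =>
      hm.1 ((eval_prod_X_sub_C_eq_zero_iff 0 A x hmx.symm).1 h₀)

/-- All graded pieces of `D(R_A, J)` for `R_A = ℂ[s², s³, t]` and `J = ⟨s²t, s³t⟩`: the
vanishing ideal of `{a ∈ S : a + d ∉ JMon}` is the principal ideal generated by
`(∏_{i ∈ ℕ, i ≤ 1−d₁, i ≠ 1} (θ₁ − i)) · (∏_{j=0}^{−d₂} (θ₂ − j))`
(empty products equal to `1`). -/
theorem statement16 (d : ℤ × ℤ) :
    vanishingIdeal {a | a ∈ SsetG ∧ a + d ∉ JMonG} =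
      Ideal.span
        {(∏ i ∈ (Finset.range (2 - d.1).toNat).filter (fun i => i ≠ 1),
            (X 0 - C (i : ℂ))) * dfact (X 1) (-d.2)} := by
  ext f
  rw [dfact, mem_span_prod_mul_prod_iff _ _ {1} (by simp)]
  constructor
  · intro hf m n hm hmn
    have h := hf ((m : ℤ), (n : ℤ)) (by
      simp only [SsetG, Gam, JMonG, Set.mem_ofPred_eq, Prod.fst_add, Prod.snd_add]
      simp only [Finset.mem_filter, Finset.mem_range, Finset.mem_singleton] at hm hmn
      lia)
    simpa using h
  · rintro hf ⟨a, b⟩ hab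
    simp only [SsetG, Gam, JMonG, Set.mem_ofPred_eq, Prod.fst_add, Prod.snd_add] at hab
    obtain ⟨⟨⟨ha, ha₁⟩, hb⟩, hJ⟩ := hab
    lift a to ℕ using ha
    lift b to ℕ using hb
    have h := hf a b (by simpa using ha₁) (by
      simp only [Finset.mem_filter, Finset.mem_range]
      lia)
    simpa using h

end
end
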